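/- arXiv:1409.1972 — 2 statements merged into one kernel-verified Lean document; each statement's English description precedes it below -/
import Mathlib

section
/- Let $b > 0$, let $\alpha^*$ be the smooth extension to $(-\tfrac{\pi^2}{8b^2},\infty)$ of $\lambda \mapsto \sqrt{2\lambda}\,\tanh(b\sqrt{2\lambda})$, let $V := (\alpha^*)^{-1}$, and define $V^*(x) := \sup_{\alpha \in \mathbb{R}} (\alpha x - V(\alpha))$ for $x > 0$. Then $V^*$ is twice differentiable on $(0,\infty)$ with $(V^*)''(x) = -\dfrac{1}{x^3\,(\alpha^*)''(\lambda^*(x))} > 0$ for every $x > 0$, where $\lambda^*(x)$ is the unique solution of $(\alpha^*)'(\lambda) = 1/x$; in particular $V^*$ is strictly convex on $(0,\infty)$. -/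
open scoped Real

/-- The smooth extension of `λ ↦ √(2λ) tanh(b√(2λ))` to `(-π²/(8b²), ∞)`, given for
negative arguments by `-√(-2λ) tan(b√(-2λ))`. -/
noncomputable def alphaStar (b lam : ℝ) : ℝ :=
  if 0 ≤ lam then Real.sqrt (2 * lam) * Real.tanh (b * Real.sqrt (2 * lam))
  else -(Real.sqrt (-(2 * lam)) * Real.tan (b * Real.sqrt (-(2 * lam))))

open scoped Nat
open Set Filter Topology

section Legendre

variable {s : Set ℝ} {f μ : ℝ → ℝ}

/-- A concave differentiable function lies below its tangent lines. -/
theorem ConcaveOn.le_add_deriv_mul (hf : ConcaveOn ℝ s f) {x y : ℝ} (hx : x ∈ s) (hy : y ∈ s)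
    (hd : DifferentiableAt ℝ f x) : f y ≤ f x + deriv f x * (y - x) := by
  rcases lt_trichotomy x y with h | rfl | h
  · have := hf.slope_le_deriv hx hy h hd
    rw [slope_def_field, div_le_iff₀ (sub_pos.2 h)] at this
    linarith
  · simp
  · have := hf.deriv_le_slope hy hx h hd
    rw [slope_def_field, le_div_iff₀ (sub_pos.2 h)] at this
    linarith

theorem strictMonoOn_of_deriv_comp_eq_inv (hanti : StrictAntiOn (deriv f) s)
    (hμ : ∀ x, 0 < x → μ x ∈ s) (hμd : ∀ x, 0 < x → deriv f (μ x) = 1 / x) :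
    StrictMonoOn μ (Ioi 0) := by
  intro x hx y hy hxy
  rw [← hanti.lt_iff_gt (hμ y hy) (hμ x hx), hμd x hx, hμd y hy]
  exact one_div_lt_one_div_of_lt hx hxy

/-- Derivative of the selection `μ` of the solution of `deriv f l = 1 / x`. -/
theorem hasDerivAt_of_deriv_comp_eq_inv (hs : IsOpen s) (hanti : StrictAntiOn (deriv f) s)
    (hf2 : ∀ l ∈ s, deriv (deriv f) l < 0) (hpos : ∀ l ∈ s, 0 < deriv f l)
    (hμ : ∀ x, 0 < x → μ x ∈ s) (hμd : ∀ x, 0 < x → deriv f (μ x) = 1 / x)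
    {x : ℝ} (hx : 0 < x) :
    HasDerivAt μ (-(1 / (x ^ 2 * deriv (deriv f) (μ x)))) x := by
  have himg : s ⊆ μ '' Ioi 0 := fun l hl ↦ by
    have h0 : 0 < 1 / deriv f l := one_div_pos.2 (hpos l hl)
    refine ⟨_, h0, hanti.injOn (hμ _ h0) hl ?_⟩
    rw [hμd _ h0, one_div_one_div]
  have hcont : ContinuousAt μ x :=
    (strictMonoOn_of_deriv_comp_eq_inv hanti hμ hμd).continuousAt_of_image_mem_nhds
      (Ioi_mem_nhds hx) (mem_of_superset (hs.mem_nhds (hμ x hx)) himg)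
  have hneg := hf2 _ (hμ x hx)
  have hd : HasDerivAt (fun l ↦ (deriv f l)⁻¹)
      (-deriv (deriv f) (μ x) / deriv f (μ x) ^ 2) (μ x) :=
    (differentiableAt_of_deriv_ne_zero hneg.ne).hasDerivAt.fun_inv (hpos _ (hμ x hx)).ne'
  have hne : -deriv (deriv f) (μ x) / deriv f (μ x) ^ 2 ≠ 0 :=
    div_ne_zero (neg_ne_zero.2 hneg.ne) (pow_ne_zero _ (hpos _ (hμ x hx)).ne')
  have hinv : ∀ᶠ y in 𝓝 x, (deriv f (μ y))⁻¹ = y := by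
    filter_upwards [Ioi_mem_nhds hx] with y hy
    rw [hμd y hy, one_div, inv_inv]
  refine (hd.of_local_left_inverse hcont hne hinv).congr_deriv ?_
  rw [hμd x hx]
  field_simp

/-- The concave conjugate `x ↦ x f(μ(x)) - μ(x)` has derivative `f ∘ μ`. -/
theorem hasDerivAt_mul_comp_sub {m' x : ℝ} (hμ' : HasDerivAt μ m' x) (hx : 0 < x)
    (hf : DifferentiableAt ℝ f (μ x)) (hμd : deriv f (μ x) = 1 / x) :
    HasDerivAt (fun y ↦ y * f (μ y) - μ y) (f (μ x)) x := by
  have h := ((hasDerivAt_id' x).mul (hf.hasDerivAt.comp x hμ')).sub hμ'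
  refine h.congr_deriv ?_
  rw [hμd]
  simp only [Function.comp]
  field_simp
  ring

/-- The Legendre transform of the inverse `V` of an increasing, strictly concave function `f`. -/
theorem isLUB_mul_sub_of_inverse (hconc : ConcaveOn ℝ s f) {V : ℝ → ℝ}
    (hinj : InjOn f s) (hV : ∀ α, V α ∈ s ∧ f (V α) = α) {x l : ℝ} (hx : 0 < x) (hl : l ∈ s)
    (hd : DifferentiableAt ℝ f l) (hld : deriv f l = 1 / x) :
    IsLUB (range fun α ↦ α * x - V α) (x * f l - l) := by
  refine IsGreatest.isLUB ⟨⟨f l, ?_⟩, ?_⟩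
  · beta_reduce
    rw [hinj (hV (f l)).1 hl (hV (f l)).2, mul_comm]
  · rintro _ ⟨α, rfl⟩
    have h := hconc.le_add_deriv_mul hl (hV α).1 hd
    rw [(hV α).2, hld] at h
    have h' := mul_le_mul_of_nonneg_left h hx.le
    have : x * (f l + 1 / x * (V α - l)) = x * f l + (V α - l) := by field_simp
    simp only
    linarith

theorem legendre_transform_deriv_two (hs : IsOpen s) (hconv : Convex ℝ s)
    (hpos : ∀ l ∈ s, 0 < deriv f l) (hf2 : ∀ l ∈ s, deriv (deriv f) l < 0)
    {V Vstar : ℝ → ℝ} (hV : ∀ α, V α ∈ s ∧ f (V α) = α)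
    (hVstar : ∀ x, 0 < x → IsLUB (range fun α ↦ α * x - V α) (Vstar x))
    (hμ : ∀ x, 0 < x → μ x ∈ s) (hμd : ∀ x, 0 < x → deriv f (μ x) = 1 / x) :
    (∀ x : ℝ, 0 < x →
      DifferentiableAt ℝ Vstar x ∧
      DifferentiableAt ℝ (deriv Vstar) x ∧
      deriv (deriv Vstar) x = -(1 / (x ^ 3 * deriv (deriv f) (μ x))) ∧
      0 < deriv (deriv Vstar) x) ∧
    StrictConvexOn ℝ (Ioi 0) Vstar := by
  have hdf : ∀ l ∈ s, DifferentiableAt ℝ f l := fun l hl ↦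
    differentiableAt_of_deriv_ne_zero (hpos l hl).ne'
  have hfc : ContinuousOn f s := fun l hl ↦ (hdf l hl).continuousAt.continuousWithinAt
  have hanti : StrictAntiOn (deriv f) s := strictAntiOn_of_deriv_neg hconv
    (fun l hl ↦ (differentiableAt_of_deriv_ne_zero
      (hf2 l hl).ne).continuousAt.continuousWithinAt)
    (fun l hl ↦ hf2 l (interior_subset hl))
  have hinj : InjOn f s := (strictMonoOn_of_deriv_pos hconv hfc
    fun l hl ↦ hpos l (interior_subset hl)).injOn
  have hconc : ConcaveOn ℝ s f :=
    (strictConcaveOn_of_deriv2_neg' hconv hfc fun l hl ↦ hf2 l hl).concaveOn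
  have hval : ∀ x, 0 < x → Vstar x = x * f (μ x) - μ x := fun x hx ↦
    (hVstar x hx).unique
      (isLUB_mul_sub_of_inverse hconc hinj hV hx (hμ x hx) (hdf _ (hμ x hx)) (hμd x hx))
  have hμ' := fun x (hx : 0 < x) ↦ hasDerivAt_of_deriv_comp_eq_inv hs hanti hf2 hpos hμ hμd hx
  have h1 : ∀ x, 0 < x → HasDerivAt Vstar (f (μ x)) x := fun x hx ↦ by
    refine (hasDerivAt_mul_comp_sub (hμ' x hx) hx (hdf _ (hμ x hx))
      (hμd x hx)).congr_of_eventuallyEq ?_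
    filter_upwards [Ioi_mem_nhds hx] with y hy using hval y hy
  have h2 : ∀ x, 0 < x →
      HasDerivAt (deriv Vstar) (-(1 / (x ^ 3 * deriv (deriv f) (μ x)))) x := fun x hx ↦ by
    have h := ((hdf _ (hμ x hx)).hasDerivAt.comp x (hμ' x hx)).congr_of_eventuallyEq
      (f₁ := deriv Vstar) (by
        filter_upwards [Ioi_mem_nhds hx] with y hy using (h1 y hy).deriv)
    refine h.congr_deriv ?_
    have := (hf2 _ (hμ x hx)).ne
    rw [hμd x hx]
    field_simp
  have h3 : ∀ x, 0 < x → 0 < deriv (deriv Vstar) x := fun x hx ↦ by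
    rw [(h2 x hx).deriv]
    exact neg_pos.2 (one_div_neg.2 (mul_neg_of_pos_of_neg (pow_pos hx 3) (hf2 _ (hμ x hx))))
  exact ⟨fun x hx ↦ ⟨(h1 x hx).differentiableAt, (h2 x hx).differentiableAt,
      (h2 x hx).deriv, h3 x hx⟩,
    strictConvexOn_of_deriv2_pos' (convex_Ioi 0)
      (fun x hx ↦ (h1 x hx).continuousAt.continuousWithinAt) fun x hx ↦ h3 x hx⟩

end Legendre

section SqrtSeries

/-- The entire function `∑ zⁿ / (2n+1)!`, equal to `sinh √z / √z` for `z > 0` and to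
`sin √(-z) / √(-z)` for `z < 0`. -/
noncomputable def sinhcSqrt : ℝ → ℝ :=
  FormalMultilinearSeries.ofScalarsSum (E := ℝ) fun n ↦ (((2 * n + 1)! : ℕ) : ℝ)⁻¹

/-- The function equal to `cosh √z` for `z ≥ 0` and to `cos √(-z)` for `z ≤ 0`. -/
noncomputable def coshSqrt (z : ℝ) : ℝ := Real.cosh √z * Real.cos √(-z)

theorem sinhcSqrt_eq_tsum (z : ℝ) : sinhcSqrt z = ∑' n : ℕ, z ^ n / ((2 * n + 1)! : ℕ) := by
  rw [sinhcSqrt, FormalMultilinearSeries.ofScalars_sum_eq]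
  exact tsum_congr fun n ↦ by rw [smul_eq_mul, div_eq_inv_mul]

theorem mul_sinhcSqrt_sq (x : ℝ) : x * sinhcSqrt (x ^ 2) = Real.sinh x := by
  rw [sinhcSqrt_eq_tsum, ← tsum_mul_left, Real.sinh_eq_tsum]
  exact tsum_congr fun n ↦ by ring

theorem mul_sinhcSqrt_neg_sq (x : ℝ) : x * sinhcSqrt (-x ^ 2) = Real.sin x := by
  rw [sinhcSqrt_eq_tsum, ← tsum_mul_left, Real.sin_eq_tsum]
  exact tsum_congr fun n ↦ by rw [neg_pow]; ring

theorem coshSqrt_sq {x : ℝ} (hx : 0 ≤ x) : coshSqrt (x ^ 2) = Real.cosh x := by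
  rw [coshSqrt, Real.sqrt_sq hx, Real.sqrt_eq_zero_of_nonpos (neg_nonpos.2 (sq_nonneg x)),
    Real.cos_zero, mul_one]

theorem coshSqrt_neg_sq {x : ℝ} (hx : 0 ≤ x) : coshSqrt (-x ^ 2) = Real.cos x := by
  rw [coshSqrt, neg_neg, Real.sqrt_sq hx,
    Real.sqrt_eq_zero_of_nonpos (neg_nonpos.2 (sq_nonneg x)), Real.cosh_zero, one_mul]

theorem sinhcSqrt_zero : sinhcSqrt 0 = 1 := by simp [sinhcSqrt]

theorem coshSqrt_zero : coshSqrt 0 = 1 := by simp [coshSqrt]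

theorem hasDerivAt_sinhcSqrt_zero : HasDerivAt sinhcSqrt (1 / 6) 0 := by
  have hr : (FormalMultilinearSeries.ofScalars ℝ
      fun n : ℕ ↦ (((2 * n + 1)! : ℕ) : ℝ)⁻¹).radius = ⊤ := by
    refine FormalMultilinearSeries.ofScalars_radius_eq_top_of_tendsto ℝ _
      (Eventually.of_forall fun n ↦ by positivity) ?_
    refine squeeze_zero (fun n ↦ by positivity) (fun n ↦ ?_)
      tendsto_one_div_add_atTop_nhds_zero_nat
    have : (2 * n.succ + 1)! = (2 * n + 3) * ((2 * n + 2) * (2 * n + 1)!) := by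
      rw [show 2 * n.succ + 1 = 2 * n + 1 + 1 + 1 by omega, Nat.factorial_succ,
        Nat.factorial_succ]
    have h0 : (0 : ℝ) < ((2 * n + 1)! : ℕ) := by positivity
    rw [this, norm_inv, norm_inv, RCLike.norm_natCast, RCLike.norm_natCast]
    push_cast
    field_simp
    nlinarith [(Nat.cast_nonneg n : (0 : ℝ) ≤ n)]
  have h := FormalMultilinearSeries.hasFPowerSeriesOnBall _ (hr ▸ ENNReal.zero_lt_top)
  refine h.hasFPowerSeriesAt.hasDerivAt.congr_deriv ?_
  rw [FormalMultilinearSeries.ofScalars_apply_eq]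
  norm_num [Nat.factorial]

theorem eq_sq_or_eq_neg_sq (z : ℝ) : ∃ x, 0 ≤ x ∧ (z = x ^ 2 ∨ z = -x ^ 2) := by
  rcases le_total 0 z with h | h
  · exact ⟨√z, Real.sqrt_nonneg _, .inl (Real.sq_sqrt h).symm⟩
  · exact ⟨√(-z), Real.sqrt_nonneg _, .inr (by rw [Real.sq_sqrt (neg_nonneg.2 h), neg_neg])⟩

theorem coshSqrt_sq_sub (z : ℝ) : coshSqrt z ^ 2 - z * sinhcSqrt z ^ 2 = 1 := by
  obtain ⟨x, hx, rfl | rfl⟩ := eq_sq_or_eq_neg_sq z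
  · rw [coshSqrt_sq hx, ← mul_pow, mul_sinhcSqrt_sq, Real.cosh_sq]; ring
  · rw [coshSqrt_neg_sq hx, neg_mul, ← mul_pow, mul_sinhcSqrt_neg_sq, sub_neg_eq_add,
      Real.cos_sq_add_sin_sq]

theorem hasDerivAt_sinhcSqrt {z : ℝ} (hz : z ≠ 0) :
    HasDerivAt sinhcSqrt ((coshSqrt z - sinhcSqrt z) / (2 * z)) z := by
  rcases hz.lt_or_gt with h | h
  · have h' : 0 < -z := neg_pos.2 h
    have hs : 0 < √(-z) := Real.sqrt_pos.2 h'
    have hz : z = -√(-z) ^ 2 := by rw [Real.sq_sqrt h'.le, neg_neg]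
    have hd : HasDerivAt (fun y ↦ √(-y)) (-1 / (2 * √(-z))) z :=
      (hasDerivAt_neg z).sqrt h'.ne'
    have hq := (((Real.hasDerivAt_sin _).comp z hd).div hd hs.ne').congr_of_eventuallyEq
      (f₁ := sinhcSqrt) (by
        filter_upwards [Iio_mem_nhds h] with y hy
        have hy' : 0 < -y := neg_pos.2 hy
        have := mul_sinhcSqrt_neg_sq √(-y)
        rw [Real.sq_sqrt hy'.le, neg_neg] at this
        simp only [Pi.div_apply, Function.comp, ← this]
        rw [mul_div_cancel_left₀ _ (Real.sqrt_pos.2 hy').ne'])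
    refine hq.congr_deriv ?_
    simp only [Function.comp]
    generalize √(-z) = x at hs hz ⊢
    subst hz
    rw [coshSqrt_neg_sq hs.le, ← mul_sinhcSqrt_neg_sq]
    field_simp
    ring
  · have hs : 0 < √z := Real.sqrt_pos.2 h
    have hz : z = √z ^ 2 := by rw [Real.sq_sqrt h.le]
    have hd : HasDerivAt (fun y ↦ √y) (1 / (2 * √z)) z := (hasDerivAt_id' z).sqrt h.ne'
    have hq := (((Real.hasDerivAt_sinh _).comp z hd).div hd hs.ne').congr_of_eventuallyEq
      (f₁ := sinhcSqrt) (by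
        filter_upwards [Ioi_mem_nhds h] with y hy
        have := mul_sinhcSqrt_sq √y
        rw [Real.sq_sqrt (le_of_lt hy)] at this
        simp only [Pi.div_apply, Function.comp, ← this]
        rw [mul_div_cancel_left₀ _ (Real.sqrt_pos.2 hy).ne'])
    refine hq.congr_deriv ?_
    simp only [Function.comp]
    generalize √z = x at hs hz ⊢
    subst hz
    rw [coshSqrt_sq hs.le, ← mul_sinhcSqrt_sq]
    field_simp

theorem hasDerivAt_coshSqrt (z : ℝ) : HasDerivAt coshSqrt (sinhcSqrt z / 2) z := by
  refine hasDerivAt_of_hasDerivAt_of_ne' (g := fun z ↦ sinhcSqrt z / 2) (x := 0)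
    (fun y hy ↦ ?_) ?_ (hasDerivAt_sinhcSqrt_zero.continuousAt.div_const 2) z
  · rcases hy.lt_or_gt with h | h
    · have h' : 0 < -y := neg_pos.2 h
      have hd : HasDerivAt (fun y ↦ √(-y)) (-1 / (2 * √(-y))) y :=
        (hasDerivAt_neg y).sqrt h'.ne'
      refine (((Real.hasDerivAt_cos _).comp y hd).congr_of_eventuallyEq (f₁ := coshSqrt) (by
        filter_upwards [Iio_mem_nhds h] with w hw
        rw [coshSqrt, Real.sqrt_eq_zero_of_nonpos (le_of_lt hw), Real.cosh_zero, one_mul,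
          Function.comp])).congr_deriv ?_
      have hs : 0 < √(-y) := Real.sqrt_pos.2 h'
      rw [← mul_sinhcSqrt_neg_sq, Real.sq_sqrt h'.le, neg_neg]
      field_simp
    · have hd : HasDerivAt (fun y ↦ √y) (1 / (2 * √y)) y := (hasDerivAt_id' y).sqrt h.ne'
      refine (((Real.hasDerivAt_cosh _).comp y hd).congr_of_eventuallyEq (f₁ := coshSqrt) (by
        filter_upwards [Ioi_mem_nhds h] with w hw
        rw [coshSqrt, Real.sqrt_eq_zero_of_nonpos (neg_nonpos.2 (le_of_lt hw)), Real.cos_zero,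
          mul_one, Function.comp])).congr_deriv ?_
      have hs : 0 < √y := Real.sqrt_pos.2 h
      rw [← mul_sinhcSqrt_sq, Real.sq_sqrt h.le]
      field_simp
  · unfold coshSqrt
    fun_prop

theorem exists_hasDerivAt_sinhcSqrt (z : ℝ) :
    ∃ d, HasDerivAt sinhcSqrt d z ∧ 2 * z * d = coshSqrt z - sinhcSqrt z ∧
      (z = 0 → d = 1 / 6) := by
  rcases eq_or_ne z 0 with rfl | hz
  · exact ⟨_, hasDerivAt_sinhcSqrt_zero, by simp [sinhcSqrt_zero, coshSqrt_zero], fun _ ↦ rfl⟩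
  · exact ⟨_, hasDerivAt_sinhcSqrt hz, by field_simp, fun h ↦ absurd h hz⟩

theorem lt_pi_div_two_of_neg_sq {x : ℝ} (hz : -(π ^ 2 / 4) < -x ^ 2) : x < π / 2 :=
  lt_of_pow_lt_pow_left₀ 2 (by positivity) (by linarith [div_pow π 2 2])

theorem coshSqrt_pos {z : ℝ} (hz : -(π ^ 2 / 4) < z) : 0 < coshSqrt z := by
  obtain ⟨x, hx, rfl | rfl⟩ := eq_sq_or_eq_neg_sq z
  · rw [coshSqrt_sq hx]; exact Real.cosh_pos x
  · rw [coshSqrt_neg_sq hx]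
    exact Real.cos_pos_of_mem_Ioo ⟨by linarith [Real.pi_pos], lt_pi_div_two_of_neg_sq hz⟩

theorem sinhcSqrt_pos {z : ℝ} (hz : -(π ^ 2 / 4) < z) : 0 < sinhcSqrt z := by
  obtain ⟨x, hx, h⟩ := eq_sq_or_eq_neg_sq z
  rcases hx.eq_or_lt with rfl | hx
  · have : z = 0 := by simpa using h
    rw [this, sinhcSqrt_zero]; exact one_pos
  rcases h with rfl | rfl
  · refine pos_of_mul_pos_right (a := x) ?_ hx.le
    rw [mul_sinhcSqrt_sq]; exact Real.sinh_pos_iff.2 hx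
  · refine pos_of_mul_pos_right (a := x) ?_ hx.le
    rw [mul_sinhcSqrt_neg_sq]
    exact Real.sin_pos_of_pos_of_lt_pi hx (by linarith [lt_pi_div_two_of_neg_sq hz])

/-- Up to the factor `coshSqrt z ^ 2`, the derivative of `tanh √z / √z` is negative. -/
theorem deriv_sinhcSqrt_mul_coshSqrt_sub_neg {z d : ℝ}
    (hd : 2 * z * d = coshSqrt z - sinhcSqrt z) (hd0 : z = 0 → d = 1 / 6) :
    d * coshSqrt z - sinhcSqrt z ^ 2 / 2 < 0 := by
  have key : 2 * z * (d * coshSqrt z - sinhcSqrt z ^ 2 / 2) =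
      1 - sinhcSqrt z * coshSqrt z := by
    linear_combination coshSqrt z * hd + coshSqrt_sq_sub z
  obtain ⟨x, hx, h⟩ := eq_sq_or_eq_neg_sq z
  rcases hx.eq_or_lt with rfl | hx
  · have : z = 0 := by simpa using h
    rw [hd0 this, this, sinhcSqrt_zero, coshSqrt_zero]; norm_num
  rcases h with rfl | rfl
  · have h1 : 2 * x < Real.sinh (2 * x) := Real.self_lt_sinh_iff.2 (by linarith)
    rw [Real.sinh_two_mul, ← mul_sinhcSqrt_sq, ← coshSqrt_sq hx.le] at h1
    have h2 : 1 < sinhcSqrt (x ^ 2) * coshSqrt (x ^ 2) := by nlinarith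
    refine neg_of_mul_neg_right (a := 2 * x ^ 2) ?_ (by positivity)
    linarith
  · have h1 : Real.sin (2 * x) < 2 * x := Real.sin_lt (by linarith)
    rw [Real.sin_two_mul, ← mul_sinhcSqrt_neg_sq, ← coshSqrt_neg_sq hx.le] at h1
    have h2 : sinhcSqrt (-x ^ 2) * coshSqrt (-x ^ 2) < 1 := by nlinarith
    refine neg_of_mul_pos_right (a := 2 * -x ^ 2) ?_ (by nlinarith [sq_nonneg x])
    linarith

/-- The smooth function `√z tanh √z`. -/
noncomputable def sqrtMulTanh (z : ℝ) : ℝ := z * sinhcSqrt z / coshSqrt z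

theorem hasDerivAt_sqrtMulTanh {z : ℝ} (hz : -(π ^ 2 / 4) < z) :
    HasDerivAt sqrtMulTanh ((sinhcSqrt z * coshSqrt z + 1) / (2 * coshSqrt z ^ 2)) z := by
  obtain ⟨d, hd, hd', -⟩ := exists_hasDerivAt_sinhcSqrt z
  have hc := coshSqrt_pos hz
  refine (((hasDerivAt_id' z).mul hd).div (hasDerivAt_coshSqrt z) hc.ne').congr_deriv ?_
  simp only [Pi.mul_apply]
  field_simp
  linear_combination coshSqrt z * hd' + coshSqrt_sq_sub z

theorem deriv_sqrtMulTanh_pos {z : ℝ} (hz : -(π ^ 2 / 4) < z) : 0 < deriv sqrtMulTanh z := by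
  rw [(hasDerivAt_sqrtMulTanh hz).deriv]
  have := coshSqrt_pos hz
  have := sinhcSqrt_pos hz
  positivity

theorem deriv_deriv_sqrtMulTanh_neg {z : ℝ} (hz : -(π ^ 2 / 4) < z) :
    deriv (deriv sqrtMulTanh) z < 0 := by
  obtain ⟨d, hd, hd', hd0⟩ := exists_hasDerivAt_sinhcSqrt z
  have hc := coshSqrt_pos hz
  have hs := sinhcSqrt_pos hz
  have hw := deriv_sinhcSqrt_mul_coshSqrt_sub_neg hd' hd0
  have hD := (((hd.mul (hasDerivAt_coshSqrt z)).add_const 1).div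
    (((hasDerivAt_coshSqrt z).pow 2).const_mul 2) (by simp [hc.ne'])).congr_of_eventuallyEq
    (f₁ := deriv sqrtMulTanh) (by
      filter_upwards [Ioi_mem_nhds hz] with y hy using (hasDerivAt_sqrtMulTanh hy).deriv)
  have heq : deriv (deriv sqrtMulTanh) z =
      ((d * coshSqrt z - sinhcSqrt z ^ 2 / 2) * coshSqrt z - sinhcSqrt z) /
        (2 * coshSqrt z ^ 3) := by
    rw [hD.deriv]
    simp only [Pi.mul_apply, Pi.pow_apply]
    field_simp
    ring
  rw [heq]
  exact div_neg_of_neg_of_pos (by nlinarith [mul_neg_of_neg_of_pos hw hc]) (by positivity)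

end SqrtSeries

section AlphaStar

variable {b : ℝ}

theorem alphaStar_eq (hb : 0 < b) :
    alphaStar b = fun l ↦ b⁻¹ * sqrtMulTanh (2 * b ^ 2 * l) := by
  ext l
  unfold alphaStar sqrtMulTanh
  split_ifs with h
  · have hs : √(2 * l) ^ 2 = 2 * l := Real.sq_sqrt (by linarith)
    have h0 := Real.sqrt_nonneg (2 * l)
    generalize √(2 * l) = x at hs h0
    rw [show 2 * b ^ 2 * l = (b * x) ^ 2 by rw [mul_pow, hs]; ring,
      coshSqrt_sq (by positivity), Real.tanh_eq_sinh_div_cosh, ← mul_sinhcSqrt_sq]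
    field_simp
  · have hs : √(-(2 * l)) ^ 2 = -(2 * l) := Real.sq_sqrt (by linarith)
    have h0 := Real.sqrt_nonneg (-(2 * l))
    generalize √(-(2 * l)) = x at hs h0
    rw [show 2 * b ^ 2 * l = -(b * x) ^ 2 by rw [mul_pow, hs]; ring,
      coshSqrt_neg_sq (by positivity), Real.tan_eq_sin_div_cos, ← mul_sinhcSqrt_neg_sq]
    field_simp

theorem deriv_alphaStar (hb : 0 < b) :
    deriv (alphaStar b) = fun l ↦ 2 * b * deriv sqrtMulTanh (2 * b ^ 2 * l) := by
  ext l
  rw [alphaStar_eq hb, deriv_const_mul_field, deriv_comp_mul_left, smul_eq_mul]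
  field_simp

theorem deriv_deriv_alphaStar (hb : 0 < b) (l : ℝ) :
    deriv (deriv (alphaStar b)) l =
      4 * b ^ 3 * deriv (deriv sqrtMulTanh) (2 * b ^ 2 * l) := by
  rw [deriv_alphaStar hb, deriv_const_mul_field, deriv_comp_mul_left, smul_eq_mul]
  ring

theorem neg_pi_sq_div_four_lt (hb : 0 < b) {l : ℝ} (hl : -(π ^ 2 / (8 * b ^ 2)) < l) :
    -(π ^ 2 / 4) < 2 * b ^ 2 * l := by
  have h := mul_lt_mul_of_pos_left hl (by positivity : 0 < 2 * b ^ 2)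
  have : 2 * b ^ 2 * -(π ^ 2 / (8 * b ^ 2)) = -(π ^ 2 / 4) := by field_simp; norm_num
  linarith

theorem deriv_alphaStar_pos (hb : 0 < b) {l : ℝ} (hl : -(π ^ 2 / (8 * b ^ 2)) < l) :
    0 < deriv (alphaStar b) l := by
  rw [deriv_alphaStar hb]
  exact mul_pos (by positivity) (deriv_sqrtMulTanh_pos (neg_pi_sq_div_four_lt hb hl))

theorem deriv_deriv_alphaStar_neg (hb : 0 < b) {l : ℝ} (hl : -(π ^ 2 / (8 * b ^ 2)) < l) :
    deriv (deriv (alphaStar b)) l < 0 := by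
  rw [deriv_deriv_alphaStar hb]
  exact mul_neg_of_pos_of_neg (by positivity)
    (deriv_deriv_sqrtMulTanh_neg (neg_pi_sq_div_four_lt hb hl))

end AlphaStar

/-- For `b > 0`, `V = (α*)⁻¹` and `V*(x) = sup_α (α x - V(α))`, the function `V*`
is twice differentiable on `(0, ∞)` with
`(V*)''(x) = -1 / (x³ (α*)''(λ*(x))) > 0`, where `λ*(x)` is the unique solution of
`(α*)'(λ) = 1/x`; in particular `V*` is strictly convex on `(0, ∞)`. -/
theorem legendre_transform_of_V_second_deriv_strict_convex (b : ℝ) (hb : 0 < b)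
    (V : ℝ → ℝ)
    (hV : ∀ α : ℝ, V α ∈ Set.Ioi (-(π ^ 2 / (8 * b ^ 2))) ∧ alphaStar b (V α) = α)
    (Vstar : ℝ → ℝ)
    (hVstar : ∀ x ∈ Set.Ici (0 : ℝ),
      IsLUB (Set.range fun α : ℝ => α * x - V α) (Vstar x))
    (lamStar : ℝ → ℝ)
    (hlamStar : ∀ x : ℝ, 0 < x →
      lamStar x ∈ Set.Ioi (-(π ^ 2 / (8 * b ^ 2))) ∧
      deriv (alphaStar b) (lamStar x) = 1 / x ∧
      (∀ lam ∈ Set.Ioi (-(π ^ 2 / (8 * b ^ 2))), deriv (alphaStar b) lam = 1 / x →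
        lam = lamStar x)) :
    (∀ x : ℝ, 0 < x →
      DifferentiableAt ℝ Vstar x ∧
      DifferentiableAt ℝ (deriv Vstar) x ∧
      deriv (deriv Vstar) x = -(1 / (x ^ 3 * deriv (deriv (alphaStar b)) (lamStar x))) ∧
      0 < deriv (deriv Vstar) x) ∧
    StrictConvexOn ℝ (Set.Ioi 0) Vstar := by
  exact legendre_transform_deriv_two isOpen_Ioi (convex_Ioi _)
    (fun _ hl ↦ deriv_alphaStar_pos hb hl) (fun _ hl ↦ deriv_deriv_alphaStar_neg hb hl) hV
    (fun x hx ↦ hVstar x (le_of_lt hx)) (fun x hx ↦ (hlamStar x hx).1)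
    fun x hx ↦ (hlamStar x hx).2.1
end

section
/- Let $b > 0$, let $\alpha^*$ be the smooth extension to $(-\tfrac{\pi^2}{8b^2},\infty)$ of $\lambda \mapsto \sqrt{2\lambda}\,\tanh(b\sqrt{2\lambda})$, let $V := (\alpha^*)^{-1}$, and define $V^*(x) := \sup_{\alpha \in \mathbb{R}} (\alpha x - V(\alpha))$ for $x \ge 0$. Then $V^*$ attains its minimum value $0$ on $[0,\infty)$ uniquely at $x^* = \tfrac{1}{2b}$: that is, $V^*(\tfrac{1}{2b}) = 0$, and $V^*(x) > 0$ for every $x \ge 0$ with $x \ne \tfrac{1}{2b}$. -/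
open scoped Real

theorem Real.strictMono_tanh : StrictMono Real.tanh := by
  intro x y hxy
  rw [Real.tanh_eq_sinh_div_cosh, Real.tanh_eq_sinh_div_cosh,
    div_lt_div_iff₀ (Real.cosh_pos x) (Real.cosh_pos y)]
  have h : 0 < Real.sinh (y - x) := Real.sinh_pos_iff.2 (sub_pos.2 hxy)
  rw [Real.sinh_sub] at h
  linarith

theorem Real.tanh_le_self_of_nonneg {x : ℝ} (hx : 0 ≤ x) : Real.tanh x ≤ x := by
  have hd (t : ℝ) : HasDerivAt (fun t => t * Real.cosh t - Real.sinh t) (t * Real.sinh t) t := by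
    refine (((hasDerivAt_id' t).mul (Real.hasDerivAt_cosh t)).sub
      (Real.hasDerivAt_sinh t)).congr_deriv ?_
    ring
  have hmono : MonotoneOn (fun t => t * Real.cosh t - Real.sinh t) (Set.Ici 0) := by
    refine monotoneOn_of_deriv_nonneg (convex_Ici 0)
      (fun t _ => (hd t).continuousAt.continuousWithinAt)
      (fun t _ => (hd t).differentiableAt.differentiableWithinAt) fun t ht => ?_
    rw [interior_Ici, Set.mem_Ioi] at ht
    rw [(hd t).deriv]
    exact mul_nonneg ht.le (Real.sinh_nonneg_iff.2 ht.le)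
  have h := hmono Set.self_mem_Ici hx hx
  simp only [zero_mul, Real.sinh_zero, sub_zero] at h
  rw [Real.tanh_eq_sinh_div_cosh, div_le_iff₀ (Real.cosh_pos x)]
  linarith

theorem alphaStar_sq_div_two (b : ℝ) {s : ℝ} (hs : 0 ≤ s) :
    alphaStar b (s ^ 2 / 2) = s * Real.tanh (b * s) := by
  rw [alphaStar, if_pos (by positivity), mul_div_cancel₀ _ two_ne_zero, Real.sqrt_sq hs]

theorem alphaStar_neg_sq_div_two (b : ℝ) {s : ℝ} (hs : 0 < s) :
    alphaStar b (-(s ^ 2 / 2)) = -(s * Real.tan (b * s)) := by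
  rw [alphaStar, if_neg (by rw [not_le, neg_lt_zero]; positivity), mul_neg, neg_neg,
    mul_div_cancel₀ _ two_ne_zero, Real.sqrt_sq hs.le]

theorem exists_eq_sq_div_two {x : ℝ} (hx : 0 ≤ x) : ∃ s, 0 ≤ s ∧ x = s ^ 2 / 2 :=
  ⟨√(2 * x), Real.sqrt_nonneg _, by rw [Real.sq_sqrt (by positivity)]; ring⟩

theorem exists_eq_neg_sq_div_two {x : ℝ} (hx : x < 0) : ∃ s, 0 < s ∧ x = -(s ^ 2 / 2) :=
  ⟨√(-(2 * x)), Real.sqrt_pos.2 (by linarith), by rw [Real.sq_sqrt (by linarith)]; ring⟩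

theorem neg_sq_div_two_mem_Ioi_iff {b s : ℝ} (hb : 0 < b) (hs : 0 < s) :
    -(s ^ 2 / 2) ∈ Set.Ioi (-(π ^ 2 / (8 * b ^ 2))) ↔ b * s < π / 2 := by
  rw [Set.mem_Ioi, neg_lt_neg_iff, lt_div_iff₀ (by positivity),
    ← pow_lt_pow_iff_left₀ (a := b * s) (by positivity) (by positivity) two_ne_zero]
  constructor <;> intro h <;> linarith

theorem alphaStar_le {b l : ℝ} (hb : 0 < b) (hl : l ∈ Set.Ioi (-(π ^ 2 / (8 * b ^ 2)))) :
    alphaStar b l ≤ 2 * b * l := by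
  rcases le_or_gt 0 l with h | h
  · obtain ⟨s, hs, rfl⟩ := exists_eq_sq_div_two h
    rw [alphaStar_sq_div_two b hs]
    nlinarith [Real.tanh_le_self_of_nonneg (mul_nonneg hb.le hs)]
  · obtain ⟨s, hs, rfl⟩ := exists_eq_neg_sq_div_two h
    rw [neg_sq_div_two_mem_Ioi_iff hb hs] at hl
    rw [alphaStar_neg_sq_div_two b hs]
    nlinarith [Real.le_tan (mul_pos hb hs).le hl]

theorem strictMonoOn_alphaStar {b : ℝ} (hb : 0 < b) :
    StrictMonoOn (alphaStar b) (Set.Ioi (-(π ^ 2 / (8 * b ^ 2)))) := by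
  intro x hx y hy hxy
  rcases le_or_gt 0 y with h | h
  · obtain ⟨t, ht, rfl⟩ := exists_eq_sq_div_two h
    have htanh {u : ℝ} (hu : 0 ≤ u) : 0 ≤ Real.tanh (b * u) := by
      simpa using Real.strictMono_tanh.monotone (mul_nonneg hb.le hu)
    rw [alphaStar_sq_div_two b ht]
    rcases le_or_gt 0 x with h' | h'
    · obtain ⟨s, hs, rfl⟩ := exists_eq_sq_div_two h'
      have hst : s < t := by
        refine lt_of_pow_lt_pow_left₀ 2 ht ?_
        linarith
      rw [alphaStar_sq_div_two b hs]
      exact mul_lt_mul'' hst (Real.strictMono_tanh (mul_lt_mul_of_pos_left hst hb)) hs (htanh hs)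
    · have h₁ := alphaStar_le hb hx
      have h₂ : 2 * b * x < 0 := mul_neg_of_pos_of_neg (by positivity) h'
      have h₃ := mul_nonneg ht (htanh ht)
      linarith
  · obtain ⟨t, ht, rfl⟩ := exists_eq_neg_sq_div_two h
    obtain ⟨s, hs, rfl⟩ := exists_eq_neg_sq_div_two (hxy.trans h)
    have hts : t < s := by
      refine lt_of_pow_lt_pow_left₀ 2 hs.le ?_
      linarith
    rw [neg_sq_div_two_mem_Ioi_iff hb hs] at hx
    rw [alphaStar_neg_sq_div_two b hs, alphaStar_neg_sq_div_two b ht, neg_lt_neg_iff]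
    exact mul_lt_mul'' hts
      (Real.tan_lt_tan_of_nonneg_of_lt_pi_div_two (by positivity) hx
        (mul_lt_mul_of_pos_left hts hb)) ht.le
      (Real.tan_nonneg_of_nonneg_of_le_pi_div_two (by positivity)
        ((mul_lt_mul_of_pos_left hts hb).trans hx).le)

theorem exists_lt_alphaStar_mul_of_gt {b x : ℝ} (hb : 0 < b) (hx : 1 < 2 * b * x) :
    ∃ l ∈ Set.Ioi (-(π ^ 2 / (8 * b ^ 2))), l < alphaStar b l * x := by
  have hcont : ContinuousAt (fun s => Real.cosh (b * s)) 0 := by fun_prop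
  have hev : ∀ᶠ s in nhdsWithin (0 : ℝ) (Set.Ioi 0), Real.cosh (b * s) < 2 * b * x :=
    (hcont.eventually_lt_const (by simpa using hx)).filter_mono nhdsWithin_le_nhds
  obtain ⟨s, hcosh, hs⟩ := (hev.and self_mem_nhdsWithin).exists
  have hx0 : 0 < x := pos_of_mul_pos_right (one_pos.trans hx) (by positivity)
  refine ⟨s ^ 2 / 2, ?_, ?_⟩
  · have h₁ : 0 < π ^ 2 / (8 * b ^ 2) := by positivity
    have h₂ : 0 < s ^ 2 / 2 := by positivity
    exact Set.mem_Ioi.2 (by linarith)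
  · have hsinh := Real.self_le_sinh_iff.2 (mul_pos hb hs).le
    rw [alphaStar_sq_div_two b hs.le, Real.tanh_eq_sinh_div_cosh, mul_div_assoc', div_mul_eq_mul_div,
      lt_div_iff₀ (Real.cosh_pos _)]
    calc s ^ 2 / 2 * Real.cosh (b * s) < s ^ 2 / 2 * (2 * b * x) := by gcongr
      _ = s * (b * s) * x := by ring
      _ ≤ s * Real.sinh (b * s) * x := by gcongr

theorem exists_lt_alphaStar_mul_of_lt {b x : ℝ} (hb : 0 < b) (hx0 : 0 ≤ x) (hx : 2 * b * x < 1) :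
    ∃ l ∈ Set.Ioi (-(π ^ 2 / (8 * b ^ 2))), l < alphaStar b l * x := by
  have hcont : ContinuousAt (fun s => Real.cos (b * s)) 0 := by fun_prop
  have hlin : ContinuousAt (fun s => b * s) 0 := by fun_prop
  have hev : ∀ᶠ s in nhdsWithin (0 : ℝ) (Set.Ioi 0),
      2 * b * x < Real.cos (b * s) ∧ b * s < π / 2 :=
    ((hcont.eventually_const_lt (by simpa using hx)).and
      (hlin.eventually_lt_const (by simpa using Real.pi_div_two_pos))).filter_mono
        nhdsWithin_le_nhds
  obtain ⟨s, ⟨hcos, hpi⟩, hs⟩ := (hev.and self_mem_nhdsWithin).exists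
  refine ⟨-(s ^ 2 / 2), (neg_sq_div_two_mem_Ioi_iff hb hs).2 hpi, ?_⟩
  have hcos0 : 0 < Real.cos (b * s) := lt_of_le_of_lt (by positivity) hcos
  have hsin := Real.sin_le (mul_pos hb hs).le
  rw [alphaStar_neg_sq_div_two b hs, neg_mul, neg_lt_neg_iff, Real.tan_eq_sin_div_cos,
    mul_div_assoc', div_mul_eq_mul_div, div_lt_iff₀ hcos0]
  calc s * Real.sin (b * s) * x ≤ s * (b * s) * x := by gcongr
    _ = s ^ 2 / 2 * (2 * b * x) := by ring
    _ < s ^ 2 / 2 * Real.cos (b * s) := by gcongr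

/-- For `b > 0`, `V = (α*)⁻¹` and `V*(x) = sup_α (α x - V(α))` for `x ≥ 0`,
the rate function `V*` attains its minimum value `0` on `[0, ∞)` uniquely at
`x* = 1/(2b)`: one has `V*(1/(2b)) = 0` and `V*(x) > 0` for every `x ≥ 0` with
`x ≠ 1/(2b)`. -/
theorem legendre_transform_of_V_unique_minimum (b : ℝ) (hb : 0 < b)
    (V : ℝ → ℝ)
    (hV : ∀ α : ℝ, V α ∈ Set.Ioi (-(π ^ 2 / (8 * b ^ 2))) ∧ alphaStar b (V α) = α)
    (Vstar : ℝ → ℝ)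
    (hVstar : ∀ x ∈ Set.Ici (0 : ℝ),
      IsLUB (Set.range fun α : ℝ => α * x - V α) (Vstar x)) :
    Vstar (1 / (2 * b)) = 0 ∧
    ∀ x : ℝ, 0 ≤ x → x ≠ 1 / (2 * b) → 0 < Vstar x := by
  have hV' {l : ℝ} (hl : l ∈ Set.Ioi (-(π ^ 2 / (8 * b ^ 2)))) : V (alphaStar b l) = l :=
    (strictMonoOn_alphaStar hb).injOn (hV _).1 hl (hV _).2
  refine ⟨le_antisymm ?_ ?_, fun x hx0 hx => ?_⟩
  · refine (hVstar _ (Set.mem_Ici.2 (by positivity))).2 ?_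
    rintro _ ⟨a, rfl⟩
    have h := alphaStar_le hb (hV a).1
    rw [(hV a).2] at h
    rw [sub_nonpos, mul_one_div, div_le_iff₀ (by positivity)]
    linarith
  · refine (hVstar _ (Set.mem_Ici.2 (by positivity))).1 ⟨0, ?_⟩
    have h0 : alphaStar b 0 = 0 := by simp [alphaStar]
    have hmem : (0 : ℝ) ∈ Set.Ioi (-(π ^ 2 / (8 * b ^ 2))) :=
      Set.mem_Ioi.2 (neg_lt_zero.2 (by positivity))
    have hV0 := hV' hmem
    rw [h0] at hV0
    simp [hV0]
  · obtain ⟨l, hl, hlt⟩ : ∃ l ∈ Set.Ioi (-(π ^ 2 / (8 * b ^ 2))), l < alphaStar b l * x := by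
      have hne : 2 * b * x ≠ 1 := fun h => hx (eq_one_div_of_mul_eq_one_right h)
      rcases hne.lt_or_gt with h | h
      · exact exists_lt_alphaStar_mul_of_lt hb hx0 h
      · exact exists_lt_alphaStar_mul_of_gt hb h
    have hle := (hVstar x hx0).1 ⟨alphaStar b l, rfl⟩
    simp only [hV' hl] at hle
    linarith
end
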